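/- The algebra IS₆ has exactly one non-trivial proper congruence, namely the congruence θ whose equivalence classes are {⊥̂}, {0, a, b, 1}, and {⊤̂}. -/

import Mathlib

/-- The four-element De Morgan algebra `DM₄` (the diamond), modelled as
`Bool × Bool`: `0 = (false, false)`, `1 = (true, true)`, `a = (false, true)`,
`b = (true, false)`. -/
abbrev DM4 := Bool × Bool

/-- The De Morgan negation of `DM₄`. -/
def dm4Not (p : DM4) : DM4 := (!p.2, !p.1)

/-- `IS₆`: `DM₄` with a new bottom `⊥̂` and a new top `⊤̂` adjoined. -/
abbrev IS6 := WithBot (WithTop DM4)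

/-- The negation of `IS₆`. -/
def is6Not : IS6 → IS6
  | none => some none
  | some none => none
  | some (some p) => some (some (dm4Not p))

/-- The operation `∇` of `IS₆`: `∇⊥̂ = ⊥̂` and `∇x = ⊤̂` otherwise. -/
def is6Nabla : IS6 → IS6
  | none => none
  | some _ => some none

/-- A congruence of `IS₆`: an equivalence relation compatible with all the
operations `⊓`, `⊔`, `∼`, `∇`. -/
def IS6Congr (r : IS6 → IS6 → Prop) : Prop :=
  Equivalence r ∧
  (∀ a b c d : IS6, r a b → r c d → r (a ⊓ c) (b ⊓ d)) ∧
  (∀ a b c d : IS6, r a b → r c d → r (a ⊔ c) (b ⊔ d)) ∧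
  (∀ a b : IS6, r a b → r (is6Not a) (is6Not b)) ∧
  (∀ a b : IS6, r a b → r (is6Nabla a) (is6Nabla b))

/-- The relation `θ` on `IS₆` with classes `{⊥̂}`, `{0, a, b, 1}`, `{⊤̂}`. -/
def is6Theta (x y : IS6) : Prop :=
  (x = ⊥ ∧ y = ⊥) ∨ (x = ⊤ ∧ y = ⊤) ∨
    (x ≠ ⊥ ∧ x ≠ ⊤ ∧ y ≠ ⊥ ∧ y ≠ ⊤)

/-- The bottom element `0` of the copy of `DM₄` inside `IS₆`. -/
def is6Zero : IS6 := some (some (false, false))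

/-- The top element `1` of the copy of `DM₄` inside `IS₆`. -/
def is6One : IS6 := some (some (true, true))

instance : DecidableRel is6Theta := fun x y =>
  inferInstanceAs (Decidable ((x = ⊥ ∧ y = ⊥) ∨ (x = ⊤ ∧ y = ⊤) ∨
    (x ≠ ⊥ ∧ x ≠ ⊤ ∧ y ≠ ⊥ ∧ y ≠ ⊤)))

theorem is6Theta_iff_nabla (x y : IS6) :
    is6Theta x y ↔
      is6Nabla x = is6Nabla y ∧ is6Nabla (is6Not x) = is6Nabla (is6Not y) := by
  revert x y
  decide

theorem is6Nabla_inf (x y : IS6) : is6Nabla (x ⊓ y) = is6Nabla x ⊓ is6Nabla y := by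
  revert x y
  decide

theorem is6Nabla_sup (x y : IS6) : is6Nabla (x ⊔ y) = is6Nabla x ⊔ is6Nabla y := by
  revert x y
  decide

theorem is6Not_inf (x y : IS6) : is6Not (x ⊓ y) = is6Not x ⊔ is6Not y := by
  revert x y
  decide

theorem is6Not_sup (x y : IS6) : is6Not (x ⊔ y) = is6Not x ⊓ is6Not y := by
  revert x y
  decide

theorem is6Not_not (x : IS6) : is6Not (is6Not x) = x := by
  revert x
  decide

theorem is6Nabla_of_ne_bot {x : IS6} (hx : x ≠ ⊥) : is6Nabla x = ⊤ := by
  revert x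
  decide

theorem is6Congr_is6Theta : IS6Congr is6Theta := by
  have hθ : is6Theta = fun x y =>
      is6Nabla x = is6Nabla y ∧ is6Nabla (is6Not x) = is6Nabla (is6Not y) :=
    funext₂ fun x y => propext (is6Theta_iff_nabla x y)
  rw [hθ]
  simp only [IS6Congr, is6Nabla_inf, is6Nabla_sup, is6Not_inf, is6Not_sup, is6Not_not]
  refine ⟨⟨fun x => ⟨rfl, rfl⟩, fun h => ⟨h.1.symm, h.2.symm⟩,
    fun h k => ⟨h.1.trans k.1, h.2.trans k.2⟩⟩, ?_, ?_, fun a b h => h.symm, ?_⟩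
  · rintro a b c d ⟨h₁, h₂⟩ ⟨k₁, k₂⟩
    rw [h₁, h₂, k₁, k₂]
    exact ⟨rfl, rfl⟩
  · rintro a b c d ⟨h₁, h₂⟩ ⟨k₁, k₂⟩
    rw [h₁, h₂, k₁, k₂]
    exact ⟨rfl, rfl⟩
  · rintro a b ⟨h, -⟩
    rw [h]
    exact ⟨rfl, rfl⟩

namespace IS6Congr

variable {r : IS6 → IS6 → Prop}

/-- A congruence identifying `u ≤ v` identifies all elements of the interval `[u, v]`. -/
theorem rel_of_mem_Icc (hr : IS6Congr r) {u v x y : IS6} (h : r u v)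
    (hx : x ∈ Set.Icc u v) (hy : y ∈ Set.Icc u v) : r x y := by
  obtain ⟨heq, hinf, -⟩ := hr
  have key : ∀ z ∈ Set.Icc u v, r u z := fun z hz => by
    simpa only [inf_eq_right.2 hz.1, inf_eq_left.2 hz.2] using hinf _ _ _ _ (heq.refl z) h
  exact heq.trans (heq.symm (key x hx)) (key y hy)

theorem rel_of_bot (hr : IS6Congr r) {z : IS6} (hz : z ≠ ⊥) (h : r ⊥ z) (x y : IS6) :
    r x y := by
  have h' : r ⊥ ⊤ := by
    have hn := hr.2.2.2.2 _ _ h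
    rwa [is6Nabla_of_ne_bot hz] at hn
  exact hr.rel_of_mem_Icc h' ⟨bot_le, le_top⟩ ⟨bot_le, le_top⟩

theorem rel_of_not_is6Theta (hr : IS6Congr r) {u v : IS6} (h : r u v)
    (huv : ¬ is6Theta u v) (x y : IS6) : r x y := by
  have hcases : ∀ u v : IS6, r u v → is6Nabla u ≠ is6Nabla v → r x y := by
    intro u v h hne
    by_cases hu : u = ⊥
    · subst hu
      exact hr.rel_of_bot (fun hv => hne (by rw [hv])) h x y
    · by_cases hv : v = ⊥
      · subst hv
        exact hr.rel_of_bot hu (hr.1.symm h) x y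
      · exact absurd ((is6Nabla_of_ne_bot hu).trans (is6Nabla_of_ne_bot hv).symm) hne
  rw [is6Theta_iff_nabla, not_and_or] at huv
  rcases huv with huv | huv
  · exact hcases u v h huv
  · exact hcases _ _ (hr.2.2.2.1 _ _ h) huv

set_option synthInstance.maxSize 1000 in
/-- Two distinct elements of `DM₄` are separated by the meet with one of the two
fixed points of the negation. -/
theorem exists_fixedPoint_inf (x y : IS6) (h : is6Theta x y) (hne : x ≠ y) :
    ∃ c : IS6, is6Not c = c ∧
      ((x ⊓ c = c ∧ y ⊓ c = is6Zero) ∨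
        (y ⊓ c = c ∧ x ⊓ c = is6Zero)) := by
  revert x y
  decide

theorem rel_of_is6Theta (hr : IS6Congr r) {u v : IS6} (h : r u v) (hne : u ≠ v)
    (huv : is6Theta u v) {x y : IS6} (hxy : is6Theta x y) : r x y := by
  have ⟨heq, hinf, _, hnot, _⟩ := hr
  obtain ⟨c, hc, hsep⟩ := exists_fixedPoint_inf u v huv hne
  have hmeet := hinf _ _ _ _ h (heq.refl c)
  have hc₀ : r is6Zero c := by
    rcases hsep with ⟨h₁, h₂⟩ | ⟨h₁, h₂⟩
    · rw [h₁, h₂] at hmeet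
      exact heq.symm hmeet
    · rwa [h₁, h₂] at hmeet
  have hc₁ : r is6One c := by
    have hn := hnot _ _ hc₀
    rwa [hc] at hn
  have mem : ∀ z : IS6, z ≠ ⊥ → z ≠ ⊤ →
      is6Zero ≤ z ∧ z ≤ is6One := by
    decide
  rcases hxy with ⟨rfl, rfl⟩ | ⟨rfl, rfl⟩ | ⟨hx, hx', hy, hy'⟩
  · exact heq.refl _
  · exact heq.refl _
  · exact rel_of_mem_Icc hr (heq.trans hc₀ (heq.symm hc₁)) (mem x hx hx') (mem y hy hy')

end IS6Congr

/-- `θ` is the unique non-trivial proper congruence of `IS₆`. -/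
theorem IS6_unique_nontrivial_congruence :
    IS6Congr is6Theta ∧
    ¬ (∀ x y : IS6, is6Theta x y ↔ x = y) ∧
    ¬ (∀ x y : IS6, is6Theta x y) ∧
    (∀ r : IS6 → IS6 → Prop, IS6Congr r →
      (∀ x y, r x y ↔ x = y) ∨ (∀ x y, r x y) ∨
      (∀ x y, r x y ↔ is6Theta x y)) := by
  refine ⟨is6Congr_is6Theta, fun h => ?_, fun h => ?_, fun r hr => ?_⟩
  · have h' := (h is6Zero is6One).1
      (by decide)
    exact absurd h' (by decide)
  · have h' := h ⊥ ⊤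
    exact absurd h' (by decide)
  · by_cases htriv : ∀ x y, r x y → x = y
    · exact Or.inl fun x y => ⟨htriv x y, fun h => h ▸ hr.1.refl x⟩
    refine Or.inr ?_
    by_cases hle : ∀ x y, r x y → is6Theta x y
    · push Not at htriv
      obtain ⟨u, v, huv, hne⟩ := htriv
      exact Or.inr fun x y => ⟨hle x y, hr.rel_of_is6Theta huv hne (hle u v huv)⟩
    · push Not at hle
      obtain ⟨u, v, huv, hnot⟩ := hle
      exact Or.inl (hr.rel_of_not_is6Theta huv hnot)
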